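/- For u ∈ S_d^+ and h ∈ S_d define DR(u)(h) = −2(uαh + hαu) + Bᵀ(h) + ∫_{S_d^+∖{0}} ⟨h,ξ⟩ e^{−⟨u,ξ⟩} μ(dξ). Then for every u ∈ S_d^{++}, R is Fréchet differentiable at u with derivative DR(u), i.e. ‖R(u+h) − R(u) − DR(u)(h)‖ / ‖h‖ → 0 as h → 0 in S_d; moreover the map u ↦ DR(u), from S_d^+ to the space of linear operators on S_d equipped with the operator norm, is continuous. In particular R is continuously differentiable on S_d^+ with derivative given by the above formula for all u ∈ S_d^+. -/

import Mathlib

open MeasureTheory Matrix Filter Topology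
open scoped ENNReal

attribute [local instance] Matrix.frobeniusNormedAddCommGroup Matrix.frobeniusNormedSpace

noncomputable section

/-- The space of real `d × d` matrices (the symmetric positive semidefinite ones are singled
out via `Matrix.PosSemidef`, which over `ℝ` includes symmetry). With the local Frobenius-norm
instance above, `‖·‖` is the Frobenius norm and `Matrix.trace (x * y)` is the associated trace
inner product. -/
abbrev Mat (d : ℕ) := Matrix (Fin d) (Fin d) ℝ

instance {d : ℕ} : MeasurableSpace (Mat d) :=
  (inferInstance : MeasurableSpace (Fin d → Fin d → ℝ))

variable {d : ℕ}

/-- The trace inner product `⟨x, y⟩ = tr (x y)`. -/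
def trIP (x y : Mat d) : ℝ := (x * y).trace

/-- The set `S_d^+ \ {0}` of nonzero symmetric positive semidefinite matrices. -/
def coneNZ (d : ℕ) : Set (Mat d) := {ξ | ξ.PosSemidef ∧ ξ ≠ 0}

/-- The (entrywise) integral `∫_{S_d^+ \ {0}} g(ξ) μ(dξ)` of a scalar function `g` against the
`S_d^+`-valued measure `μ(dξ) = ρ(ξ) ν(dξ)` represented by a base measure `ν` and a
matrix-valued density `ρ`. -/
def muInt (ν : Measure (Mat d)) (ρ : Mat d → Mat d) (g : Mat d → ℝ) : Mat d :=
  Matrix.of fun i j => ∫ ξ in coneNZ d, g ξ * ρ ξ i j ∂ν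

/-- `F(u) = ⟨b,u⟩ + ∫_{S_d^+ \ {0}} (1 - e^{-⟨u,ξ⟩}) m(dξ)`. -/
def Ffun (b : Mat d) (m : Measure (Mat d)) (u : Mat d) : ℝ :=
  trIP b u + ∫ ξ in coneNZ d, (1 - Real.exp (-(trIP u ξ))) ∂m

/-- `R(u) = -2uαu + Bᵀ(u) - ∫_{S_d^+ \ {0}} (e^{-⟨u,ξ⟩} - 1) μ(dξ)`, with `Bt = Bᵀ` and
`μ(dξ) = ρ(ξ) ν(dξ)`. -/
def Rfun (α : Mat d) (Bt : Mat d →L[ℝ] Mat d) (ν : Measure (Mat d)) (ρ : Mat d → Mat d)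
    (u : Mat d) : Mat d :=
  (-2 : ℝ) • (u * α * u) + Bt u - muInt ν ρ (fun ξ => Real.exp (-(trIP u ξ)) - 1)

/-- An admissible parameter set `(α, b, B, m, μ)`.  The `S_d^+`-valued σ-finite measure `μ` on
`S_d^+ \ {0}` is represented (via Radon–Nikodym) by its matrix-valued density `ρ` with respect
to a σ-finite base measure `ν`, so that `μ(dξ) = ρ(ξ) ν(dξ)` and
`tr(μ)(dξ) = tr(ρ(ξ)) ν(dξ)`; `Bt` denotes the adjoint `Bᵀ` of the linear drift `B` with
respect to the trace inner product.  Measures on `S_d^+ \ {0}` are realized as measures on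
matrix space, all integrals against them being taken over `coneNZ d`. -/
structure Admissible (d : ℕ) where
  /-- linear diffusion coefficient `α ∈ S_d^+` -/
  α : Mat d
  /-- constant drift `b ∈ S_d^+` -/
  b : Mat d
  /-- linear drift `B : S_d → S_d` -/
  B : Mat d →L[ℝ] Mat d
  /-- adjoint of the linear drift -/
  Bt : Mat d →L[ℝ] Mat d
  /-- constant jump term: a Borel measure `m` on `S_d^+ \ {0}` -/
  m : Measure (Mat d)
  /-- base measure of the linear jump coefficient `μ` -/
  ν : Measure (Mat d)
  /-- matrix-valued density of `μ` with respect to `ν` -/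
  ρ : Mat d → Mat d
  hα : α.PosSemidef
  hb : b.PosSemidef
  /-- `b ⪰ (d-1) α` -/
  hbα : (b - ((d : ℝ) - 1) • α).PosSemidef
  /-- `∫ (‖ξ‖ ∧ 1) m(dξ) < ∞` -/
  hm : IntegrableOn (fun ξ => min ‖ξ‖ 1) (coneNZ d) m
  hν : SigmaFinite ν
  hρmeas : Measurable ρ
  /-- `μ` is `S_d^+`-valued -/
  hρpsd : ∀ᵐ ξ ∂(ν.restrict (coneNZ d)), (ρ ξ).PosSemidef
  /-- `∫ ‖ξ‖ tr(μ)(dξ) < ∞` -/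
  hμint : IntegrableOn (fun ξ => ‖ξ‖ * (ρ ξ).trace) (coneNZ d) ν
  /-- `Bt` is the adjoint of `B` -/
  hadj : ∀ u x : Mat d, trIP u (B x) = trIP (Bt u) x
  /-- `⟨B(x),u⟩ ≥ 0` whenever `x, u ∈ S_d^+` with `⟨x,u⟩ = 0` -/
  hBpos : ∀ x u : Mat d, x.PosSemidef → u.PosSemidef → trIP x u = 0 → 0 ≤ trIP (B x) u

/-- `ψ` solves the generalized Riccati equation `∂_t ψ(t,u) = R(ψ(t,u))`, `ψ(0,u) = u`,
staying in `S_d^+` for initial conditions in `S_d^+`. -/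
def IsRiccati (P : Admissible d) (ψ : ℝ → Mat d → Mat d) : Prop :=
  (∀ u : Mat d, u.PosSemidef → ψ 0 u = u) ∧
  (∀ t : ℝ, 0 ≤ t → ∀ u : Mat d, u.PosSemidef → (ψ t u).PosSemidef) ∧
  (∀ u : Mat d, u.PosSemidef → ∀ t ∈ Set.Ici (0 : ℝ),
    HasDerivWithinAt (fun s => ψ s u) (Rfun P.α P.Bt P.ν P.ρ (ψ t u)) (Set.Ici 0) t)

/-- `φ(t,u) = ∫_0^t F(ψ(s,u)) ds`. -/
def phiFun (P : Admissible d) (ψ : ℝ → Mat d → Mat d) (t : ℝ) (u : Mat d) : ℝ :=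
  ∫ s in (0 : ℝ)..t, Ffun P.b P.m (ψ s u)

/-- `p t x` is a family of Borel probability measures supported on `S_d^+` satisfying the
affine transform formula
`∫ e^{-⟨u,ξ⟩} p_t(x,dξ) = exp (-φ(t,u) - ⟨ψ(t,u),x⟩)`. -/
def IsAffineKernel (P : Admissible d) (ψ : ℝ → Mat d → Mat d)
    (p : ℝ → Mat d → Measure (Mat d)) : Prop :=
  (∀ t : ℝ, 0 ≤ t → ∀ x : Mat d, x.PosSemidef → IsProbabilityMeasure (p t x)) ∧
  (∀ t : ℝ, 0 ≤ t → ∀ x : Mat d, x.PosSemidef → p t x {ξ : Mat d | ¬ ξ.PosSemidef} = 0) ∧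
  (∀ t : ℝ, 0 ≤ t → ∀ u x : Mat d, u.PosSemidef → x.PosSemidef →
    ∫ ξ, Real.exp (-(trIP u ξ)) ∂(p t x) =
      Real.exp (-(phiFun P ψ t u) - trIP (ψ t u) x))

/-- `Bt2` is the effective drift `B̃(u) = B(u) + ∫_{S_d^+ \ {0}} ⟨ξ,u⟩ μ(dξ)`, given as a
(continuous) linear map so that its operator exponential can be formed. -/
def IsEffectiveDrift (P : Admissible d) (Bt2 : Mat d →L[ℝ] Mat d) : Prop :=
  ∀ u : Mat d, Bt2 u = P.B u + muInt P.ν P.ρ (fun ξ => trIP ξ u)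

/-- Weak convergence of `q t` to `π` as `t → ∞`: convergence of integrals of all bounded
continuous functions. -/
def WeakTendsto (q : ℝ → Measure (Mat d)) (π : Measure (Mat d)) : Prop :=
  ∀ f : BoundedContinuousFunction (Mat d) ℝ,
    Tendsto (fun t => ∫ ξ, f ξ ∂(q t)) atTop (𝓝 (∫ ξ, f ξ ∂π))

/-- The candidate derivative of `R`:
`DR(u)(h) = -2(uαh + hαu) + Bᵀ(h) + ∫ ⟨h,ξ⟩ e^{-⟨u,ξ⟩} μ(dξ)`. -/
def DRf (α : Mat d) (Bt : Mat d →L[ℝ] Mat d) (ν : Measure (Mat d)) (ρ : Mat d → Mat d)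
    (u h : Mat d) : Mat d :=
  (-2 : ℝ) • (u * α * h + h * α * u) + Bt h +
    muInt ν ρ (fun ξ => trIP h ξ * Real.exp (-(trIP u ξ)))

lemma aux_entry_le (x : Mat d) (i j : Fin d) : |x i j| ≤ ‖x‖ := by
  rw [Matrix.frobenius_norm_def, ← Real.sqrt_eq_rpow]
  apply Real.le_sqrt_of_sq_le
  have h1 : ‖x i j‖ ^ (2:ℝ) ≤ ∑ j, ‖x i j‖ ^ (2:ℝ) :=
    Finset.single_le_sum (f := fun j => ‖x i j‖ ^ (2:ℝ)) (fun _ _ => by positivity)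
      (Finset.mem_univ j)
  have h2 : ∑ j, ‖x i j‖ ^ (2:ℝ) ≤ ∑ i, ∑ j, ‖x i j‖ ^ (2:ℝ) :=
    Finset.single_le_sum (f := fun i => ∑ j, ‖x i j‖ ^ (2:ℝ)) (fun _ _ => by positivity)
      (Finset.mem_univ i)
  refine le_trans (le_of_eq ?_) (h1.trans h2)
  simp

lemma aux_norm_le_sum (x : Mat d) : ‖x‖ ≤ ∑ i, ∑ j, |x i j| := by
  rw [Matrix.frobenius_norm_def, ← Real.sqrt_eq_rpow]
  apply Real.sqrt_le_iff.2
  refine ⟨by positivity, ?_⟩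
  have h1 : ∀ i, ∑ j, ‖x i j‖ ^ (2:ℝ) ≤ (∑ j, |x i j|) ^ 2 := by
    intro i
    simpa using Finset.sum_sq_le_sq_sum_of_nonneg (s := Finset.univ) (f := fun j => |x i j|)
      (fun _ _ => abs_nonneg _)
  refine (Finset.sum_le_sum fun i _ => h1 i).trans ?_
  exact Finset.sum_sq_le_sq_sum_of_nonneg (s := Finset.univ) (f := fun i => ∑ j, |x i j|)
      (fun _ _ => by positivity)

lemma aux_trIP (x y : Mat d) : trIP x y = ∑ i, ∑ j, x i j * y j i := by
  simp [trIP, Matrix.trace, Matrix.mul_apply]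

lemma aux_trIP_add (x h y : Mat d) : trIP (x + h) y = trIP x y + trIP h y := by
  simp [trIP, add_mul]

lemma aux_trIP_le (x y : Mat d) : |trIP x y| ≤ d * (‖x‖ * ‖y‖) := by
  have h1 : ∀ i, |(x * y) i i| ≤ ‖x‖ * ‖y‖ := fun i =>
    (aux_entry_le _ i i).trans (Matrix.frobenius_norm_mul x y)
  unfold trIP Matrix.trace
  refine (Finset.abs_sum_le_sum_abs _ _).trans ?_
  refine (Finset.sum_le_sum fun i _ => h1 i).trans ?_
  simp

open scoped MatrixOrder in
lemma aux_fact {x : Mat d} (hx : x.PosSemidef) : ∃ b : Mat d, x = bᵀ * b := by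
  obtain ⟨b, hb⟩ := CStarAlgebra.nonneg_iff_eq_star_mul_self.mp hx.nonneg
  exact ⟨b, by simpa [Matrix.star_eq_conjTranspose] using hb⟩

lemma aux_trIP_nonneg {x y : Mat d} (hx : x.PosSemidef) (hy : y.PosSemidef) :
    0 ≤ trIP x y := by
  obtain ⟨b, rfl⟩ := aux_fact hx
  have := (hy.mul_mul_conjTranspose_same b).trace_nonneg
  rw [trIP, Matrix.mul_assoc, Matrix.trace_mul_comm]
  simpa using this

lemma aux_entry_trace {x : Mat d} (hx : x.PosSemidef) (i j : Fin d) :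
    |x i j| ≤ x.trace := by
  have hd : ∀ i, x i i ≤ x.trace := fun i =>
    Finset.single_le_sum (f := fun i => x i i) (fun k _ => hx.diag_nonneg) (Finset.mem_univ i)
  have key : |x i j| ≤ (x i i + x j j) / 2 := by
    obtain ⟨b, rfl⟩ := aux_fact hx
    simp only [Matrix.mul_apply, Matrix.transpose_apply]
    refine (Finset.abs_sum_le_sum_abs _ _).trans ?_
    rw [← Finset.sum_add_distrib, Finset.sum_div]
    refine Finset.sum_le_sum fun k _ => ?_
    rw [abs_le]
    constructor <;> nlinarith [sq_nonneg (b k i - b k j), sq_nonneg (b k i + b k j)]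
  linarith [hd i, hd j]

lemma aux_exp (a b : ℝ) :
    |Real.exp (-(a + b)) - Real.exp (-a) + b * Real.exp (-a)| ≤
      |b| * |Real.exp (-(a + b)) - Real.exp (-a)| := by
  have h0 : Real.exp (-(a + b)) = Real.exp (-a) * Real.exp (-b) := by
    rw [← Real.exp_add]; ring_nf
  have h0' : Real.exp (-a) = Real.exp (-(a + b)) * Real.exp b := by
    rw [← Real.exp_add]; ring_nf
  have h1 : 0 ≤ Real.exp (-(a + b)) - Real.exp (-a) + b * Real.exp (-a) := by
    rw [h0]; nlinarith [Real.add_one_le_exp (-b), Real.exp_pos (-a)]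
  have h2 : Real.exp (-(a + b)) * (1 + b) ≤ Real.exp (-a) := by
    rw [h0']; nlinarith [Real.add_one_le_exp b, Real.exp_pos (-(a + b))]
  rw [abs_of_nonneg h1, ← abs_mul]
  refine le_trans ?_ (neg_le_abs _)
  linarith

lemma aux_meas_entry (i j : Fin d) : Measurable (fun ξ : Mat d => ξ i j) :=
  (measurable_pi_apply j).comp (measurable_pi_apply (X := fun _ : Fin d => Fin d → ℝ) i)

lemma aux_meas_trIP (u : Mat d) : Measurable (fun ξ : Mat d => trIP u ξ) := by
  simp only [aux_trIP]
  exact Finset.measurable_sum _ fun i _ => Finset.measurable_sum _ fun j _ =>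
    (aux_meas_entry j i).const_mul _

lemma aux_meas_cone : MeasurableSet (coneNZ d) := by
  have h1 : MeasurableSet {ξ : Mat d | ξ.PosSemidef} := by
    have : IsClosed {ξ : Fin d → Fin d → ℝ | (∀ i j, ξ j i = ξ i j) ∧
        ∀ x : Fin d → ℝ, 0 ≤ ∑ i, x i * ∑ j, ξ i j * x j} := by
      simp only [Set.ofPred_and, Set.ofPred_forall]
      refine IsClosed.inter ?_ ?_
      · exact isClosed_iInter fun i => isClosed_iInter fun j =>
          isClosed_eq (by fun_prop) (by fun_prop)
      · exact isClosed_iInter fun x => isClosed_le (by fun_prop) (by fun_prop)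
    have h2 := this.measurableSet
    have h3 : {ξ : Mat d | ξ.PosSemidef} = {ξ : Mat d | (∀ i j, ξ j i = ξ i j) ∧
        ∀ x : Fin d → ℝ, 0 ≤ ∑ i, x i * ∑ j, ξ i j * x j} := by
      ext ξ
      simp only [Set.mem_ofPred_eq, Matrix.posSemidef_iff_dotProduct_mulVec, Matrix.IsHermitian.ext_iff,
        star_trivial, dotProduct, Matrix.mulVec]
    rw [h3]
    exact h2
  have h2 : MeasurableSet ({0} : Set (Fin d → Fin d → ℝ)) := measurableSet_singleton _
  exact h1.inter h2.compl

lemma aux_open {u : Mat d} (hu : u.PosDef) :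
    ∀ᶠ h : Mat d in 𝓝 0, h.IsSymm → (u + h).PosSemidef := by
  have hc : Continuous fun z : Mat d × (Fin d → ℝ) => z.2 ⬝ᵥ ((u + z.1) *ᵥ z.2) := by
    fun_prop
  have hK : IsCompact (Metric.sphere (0 : Fin d → ℝ) 1) := isCompact_sphere _ _
  have := hK.eventually_forall_of_forall_eventually (x₀ := (0 : Mat d))
    (P := fun h x => 0 < x ⬝ᵥ ((u + h) *ᵥ x)) (by
      intro y hy
      have hy0 : y ≠ 0 := by
        rintro rfl; simp at hy
      apply hc.continuousAt.eventually (lt_mem_nhds _)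
      have := hu.dotProduct_mulVec_pos hy0
      simpa using this)
  filter_upwards [this] with h hh hs
  refine Matrix.PosSemidef.of_dotProduct_mulVec_nonneg (hu.1.add ?_) ?_
  · simpa [Matrix.IsHermitian, Matrix.IsSymm] using hs
  intro x
  by_cases hx : x = 0
  · simp [hx]
  have hn : 0 < ‖x‖ := norm_pos_iff.2 hx
  have h1 := hh (‖x‖⁻¹ • x) (by simp [norm_smul, hn.ne'])
  simp only [Matrix.mulVec_smul, smul_dotProduct, dotProduct_smul, smul_eq_mul] at h1
  have h2 : 0 < x ⬝ᵥ ((u + h) *ᵥ x) := by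
    have hi : 0 < ‖x‖⁻¹ := by positivity
    rw [mul_pos_iff_of_pos_left hi, mul_pos_iff_of_pos_left hi] at h1
    exact h1
  simpa using h2.le

instance aux_fc : FirstCountableTopology (Mat d) :=
  inferInstanceAs (FirstCountableTopology (Fin d → Fin d → ℝ))

lemma aux_norm_cont : Continuous (fun x : Mat d => ‖x‖) := by
  simp only [Matrix.frobenius_norm_def, ← Real.sqrt_eq_rpow, Real.rpow_two, Real.norm_eq_abs]
  fun_prop

lemma aux_integrable (P : Admissible d) (g : Mat d → ℝ) (hg : Measurable g) (C : ℝ)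
    (hC : ∀ ξ ∈ coneNZ d, |g ξ| ≤ C * ‖ξ‖) (i j : Fin d) :
    IntegrableOn (fun ξ => g ξ * P.ρ ξ i j) (coneNZ d) P.ν := by
  refine Integrable.mono' (P.hμint.const_mul C) ?_ ?_
  · exact (hg.mul ((aux_meas_entry i j).comp P.hρmeas)).aestronglyMeasurable
  · filter_upwards [P.hρpsd, ae_restrict_mem aux_meas_cone] with ξ h1 h2
    rw [Real.norm_eq_abs, abs_mul, ← mul_assoc]
    exact mul_le_mul (hC ξ h2) (aux_entry_trace h1 i j) (abs_nonneg _)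
      ((abs_nonneg _).trans (hC ξ h2))

lemma aux_muInt_le (P : Admissible d) (g K : Mat d → ℝ)
    (hK : ∀ ξ ∈ coneNZ d, |g ξ| ≤ K ξ)
    (hI : IntegrableOn (fun ξ => K ξ * (P.ρ ξ).trace) (coneNZ d) P.ν) :
    ‖muInt P.ν P.ρ g‖ ≤ (d * d : ℝ) * ∫ ξ in coneNZ d, K ξ * (P.ρ ξ).trace ∂P.ν := by
  refine (aux_norm_le_sum _).trans ?_
  have : ∀ i j, |muInt P.ν P.ρ g i j| ≤ ∫ ξ in coneNZ d, K ξ * (P.ρ ξ).trace ∂P.ν := by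
    intro i j
    simp only [muInt, Matrix.of_apply]
    rw [← Real.norm_eq_abs]
    refine norm_integral_le_of_norm_le hI ?_
    filter_upwards [P.hρpsd, ae_restrict_mem aux_meas_cone] with ξ h1 h2
    rw [Real.norm_eq_abs, abs_mul]
    exact mul_le_mul (hK ξ h2) (aux_entry_trace h1 i j) (abs_nonneg _)
      ((abs_nonneg _).trans (hK ξ h2))
  refine (Finset.sum_le_sum fun i _ => Finset.sum_le_sum fun j _ => this i j).trans ?_
  simp [mul_assoc]

/-- The modulus controlling both the remainder and the continuity of the derivative. -/
def auxG (P : Admissible d) (u v : Mat d) : ℝ :=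
  ∫ ξ in coneNZ d, |Real.exp (-(trIP v ξ)) - Real.exp (-(trIP u ξ))| *
    (‖ξ‖ * (P.ρ ξ).trace) ∂P.ν

lemma aux_expdiff {u v ξ : Mat d} (hu : u.PosSemidef) (hv : v.PosSemidef)
    (hξ : ξ.PosSemidef) : |Real.exp (-(trIP v ξ)) - Real.exp (-(trIP u ξ))| ≤ 1 := by
  have h1 := aux_trIP_nonneg hu hξ
  have h2 := aux_trIP_nonneg hv hξ
  have h3 : Real.exp (-(trIP u ξ)) ≤ 1 := Real.exp_le_one_iff.2 (by linarith)
  have h4 : Real.exp (-(trIP v ξ)) ≤ 1 := Real.exp_le_one_iff.2 (by linarith)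
  have h5 := Real.exp_pos (-(trIP u ξ))
  have h6 := Real.exp_pos (-(trIP v ξ))
  rw [abs_le]
  constructor <;> linarith

lemma aux_meas_exp (u : Mat d) : Measurable (fun ξ : Mat d => Real.exp (-(trIP u ξ))) :=
  Real.measurable_exp.comp (aux_meas_trIP u).neg

lemma aux_G_meas (P : Admissible d) (u v : Mat d) : AEStronglyMeasurable
    (fun ξ => |Real.exp (-(trIP v ξ)) - Real.exp (-(trIP u ξ))| * (‖ξ‖ * (P.ρ ξ).trace))
    (P.ν.restrict (coneNZ d)) := by
  refine AEStronglyMeasurable.mul ?_ P.hμint.aestronglyMeasurable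
  exact (((aux_meas_exp v).sub (aux_meas_exp u)).abs).aestronglyMeasurable

lemma aux_G_bound (P : Admissible d) {u v : Mat d} (hu : u.PosSemidef) (hv : v.PosSemidef) :
    ∀ᵐ ξ ∂(P.ν.restrict (coneNZ d)),
    ‖|Real.exp (-(trIP v ξ)) - Real.exp (-(trIP u ξ))| * (‖ξ‖ * (P.ρ ξ).trace)‖ ≤
      ‖ξ‖ * (P.ρ ξ).trace := by
  filter_upwards [P.hρpsd, ae_restrict_mem aux_meas_cone] with ξ h1 h2
  have h3 : 0 ≤ ‖ξ‖ * (P.ρ ξ).trace := mul_nonneg (norm_nonneg _) h1.trace_nonneg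
  rw [Real.norm_of_nonneg (mul_nonneg (abs_nonneg _) h3)]
  exact mul_le_of_le_one_left h3 (aux_expdiff hu hv h2.1)

lemma aux_G_integrable (P : Admissible d) {u v : Mat d} (hu : u.PosSemidef)
    (hv : v.PosSemidef) : IntegrableOn
    (fun ξ => |Real.exp (-(trIP v ξ)) - Real.exp (-(trIP u ξ))| * (‖ξ‖ * (P.ρ ξ).trace))
    (coneNZ d) P.ν :=
  Integrable.mono' P.hμint (aux_G_meas P u v) (aux_G_bound P hu hv)

lemma aux_G_tendsto (P : Admissible d) {u : Mat d} (hu : u.PosSemidef) :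
    Tendsto (auxG P u) (𝓝[{v : Mat d | v.PosSemidef}] u) (𝓝 0) := by
  have := tendsto_integral_filter_of_dominated_convergence
    (μ := P.ν.restrict (coneNZ d)) (l := 𝓝[{v : Mat d | v.PosSemidef}] u)
    (F := fun v ξ => |Real.exp (-(trIP v ξ)) - Real.exp (-(trIP u ξ))| *
      (‖ξ‖ * (P.ρ ξ).trace)) (f := fun _ => 0)
    (fun ξ => ‖ξ‖ * (P.ρ ξ).trace)
    (Eventually.of_forall fun v => aux_G_meas P u v)
    (by
      filter_upwards [self_mem_nhdsWithin] with v hv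
      exact aux_G_bound P hu hv)
    P.hμint
    (by
      refine Eventually.of_forall fun ξ => ?_
      have hc : Continuous fun v : Mat d =>
          |Real.exp (-(trIP v ξ)) - Real.exp (-(trIP u ξ))| * (‖ξ‖ * (P.ρ ξ).trace) := by
        unfold trIP
        fun_prop
      have := (hc.tendsto u).mono_left (nhdsWithin_le_nhds (s := {v : Mat d | v.PosSemidef}))
      simpa using this)
  rw [integral_zero] at this
  exact this

/-- Scalar functions dominated by `c * ‖ξ‖ * |e^{-⟨v,ξ⟩} - e^{-⟨u,ξ⟩}|`. -/
lemma aux_muInt_le_G (P : Admissible d) {u v : Mat d} (hu : u.PosSemidef)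
    (hv : v.PosSemidef) (g : Mat d → ℝ) (c : ℝ)
    (hg : ∀ ξ ∈ coneNZ d, |g ξ| ≤
      (c * ‖ξ‖) * |Real.exp (-(trIP v ξ)) - Real.exp (-(trIP u ξ))|) :
    ‖muInt P.ν P.ρ g‖ ≤ (d * d : ℝ) * (c * auxG P u v) := by
  have e : (fun ξ => (c * ‖ξ‖) * |Real.exp (-(trIP v ξ)) - Real.exp (-(trIP u ξ))| *
      (P.ρ ξ).trace) = fun ξ => c * (|Real.exp (-(trIP v ξ)) - Real.exp (-(trIP u ξ))| *
      (‖ξ‖ * (P.ρ ξ).trace)) := by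
    funext ξ; ring
  have := aux_muInt_le P g _ hg (by
    rw [e]; exact (aux_G_integrable P hu hv).const_mul c)
  rw [e, integral_const_mul] at this
  exact this

lemma aux_muInt_sub (P : Admissible d) (g k : Mat d → ℝ) (hg : Measurable g)
    (hk : Measurable k) (C D : ℝ) (hC : ∀ ξ ∈ coneNZ d, |g ξ| ≤ C * ‖ξ‖)
    (hD : ∀ ξ ∈ coneNZ d, |k ξ| ≤ D * ‖ξ‖) :
    muInt P.ν P.ρ g - muInt P.ν P.ρ k = muInt P.ν P.ρ (fun ξ => g ξ - k ξ) := by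
  ext i j
  simp only [muInt, Matrix.sub_apply, Matrix.of_apply]
  rw [← integral_sub (aux_integrable P g hg C hC i j) (aux_integrable P k hk D hD i j)]
  simp only [sub_mul]

lemma aux_bd_lin {u : Mat d} (hu : u.PosSemidef) (h : Mat d) : ∀ ξ ∈ coneNZ d,
    |trIP h ξ * Real.exp (-(trIP u ξ))| ≤ (d * ‖h‖) * ‖ξ‖ := by
  intro ξ hξ
  have h1 := aux_trIP_nonneg hu hξ.1
  have h3 : Real.exp (-(trIP u ξ)) ≤ 1 := Real.exp_le_one_iff.2 (by linarith)
  rw [abs_mul, Real.abs_exp]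
  refine (mul_le_of_le_one_right (abs_nonneg _) h3).trans ?_
  rw [mul_assoc]
  exact aux_trIP_le h ξ

lemma aux_bd_exp {u : Mat d} (hu : u.PosSemidef) : ∀ ξ ∈ coneNZ d,
    |Real.exp (-(trIP u ξ)) - 1| ≤ (d * ‖u‖) * ‖ξ‖ := by
  intro ξ hξ
  have h1 := aux_trIP_nonneg hu hξ.1
  have h3 : Real.exp (-(trIP u ξ)) ≤ 1 := Real.exp_le_one_iff.2 (by linarith)
  have h4 := Real.add_one_le_exp (-(trIP u ξ))
  have h5 := aux_trIP_le u ξ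
  rw [abs_of_nonneg h1] at h5
  rw [abs_of_nonpos (by linarith), mul_assoc]
  linarith

lemma aux_DR (P : Admissible d) {u v : Mat d} (hu : u.PosSemidef) (hv : v.PosSemidef)
    (h : Mat d) :
    ‖DRf P.α P.Bt P.ν P.ρ v h - DRf P.α P.Bt P.ν P.ρ u h‖ ≤
      (4 * ‖P.α‖ * ‖v - u‖ + (d * d : ℝ) * d * auxG P u v) * ‖h‖ := by
  have e : DRf P.α P.Bt P.ν P.ρ v h - DRf P.α P.Bt P.ν P.ρ u h =
      (-2 : ℝ) • ((v - u) * P.α * h + h * P.α * (v - u)) +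
      muInt P.ν P.ρ (fun ξ => trIP h ξ * Real.exp (-(trIP v ξ)) -
        trIP h ξ * Real.exp (-(trIP u ξ))) := by
    rw [← aux_muInt_sub P (fun ξ => trIP h ξ * Real.exp (-(trIP v ξ)))
      (fun ξ => trIP h ξ * Real.exp (-(trIP u ξ))) ((aux_meas_trIP h).mul (aux_meas_exp v))
      ((aux_meas_trIP h).mul (aux_meas_exp u)) _ _ (aux_bd_lin hv h) (aux_bd_lin hu h)]
    unfold DRf
    simp only [sub_mul, mul_sub, smul_add, smul_sub]
    abel
  have b1 : ‖(v - u) * P.α * h‖ ≤ ‖v - u‖ * ‖P.α‖ * ‖h‖ :=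
    (Matrix.frobenius_norm_mul _ _).trans
      (mul_le_mul_of_nonneg_right (Matrix.frobenius_norm_mul _ _) (norm_nonneg _))
  have b2 : ‖h * P.α * (v - u)‖ ≤ ‖h‖ * ‖P.α‖ * ‖v - u‖ :=
    (Matrix.frobenius_norm_mul _ _).trans
      (mul_le_mul_of_nonneg_right (Matrix.frobenius_norm_mul _ _) (norm_nonneg _))
  have b3 := aux_muInt_le_G P hu hv (fun ξ => trIP h ξ * Real.exp (-(trIP v ξ)) -
        trIP h ξ * Real.exp (-(trIP u ξ))) (d * ‖h‖) (by
    intro ξ _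
    rw [← mul_sub, abs_mul]
    refine mul_le_mul_of_nonneg_right ?_ (abs_nonneg _)
    rw [mul_assoc]
    exact aux_trIP_le h ξ)
  rw [e]
  refine (norm_add_le _ _).trans ?_
  rw [norm_smul]
  have b4 := norm_add_le ((v - u) * P.α * h) (h * P.α * (v - u))
  have : ‖(-2 : ℝ)‖ = 2 := by norm_num
  rw [this]
  nlinarith

lemma aux_R (P : Admissible d) {u h : Mat d} (hu : u.PosSemidef) (hv : (u + h).PosSemidef) :
    ‖Rfun P.α P.Bt P.ν P.ρ (u + h) - Rfun P.α P.Bt P.ν P.ρ u -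
            DRf P.α P.Bt P.ν P.ρ u h‖ ≤
      (2 * ‖P.α‖ * ‖h‖ + (d * d : ℝ) * d * auxG P u (u + h)) * ‖h‖ := by
  have e : Rfun P.α P.Bt P.ν P.ρ (u + h) - Rfun P.α P.Bt P.ν P.ρ u -
            DRf P.α P.Bt P.ν P.ρ u h =
      (-2 : ℝ) • (h * P.α * h) -
      muInt P.ν P.ρ (fun ξ => ((Real.exp (-(trIP (u + h) ξ)) - 1) -
        (Real.exp (-(trIP u ξ)) - 1)) - (-(trIP h ξ * Real.exp (-(trIP u ξ))))) := by
    have hn : muInt P.ν P.ρ (fun ξ => -(trIP h ξ * Real.exp (-(trIP u ξ)))) =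
        - muInt P.ν P.ρ (fun ξ => trIP h ξ * Real.exp (-(trIP u ξ))) := by
      ext i j
      simp only [muInt, Matrix.neg_apply, Matrix.of_apply, neg_mul, integral_neg]
    rw [← aux_muInt_sub P (fun ξ => (Real.exp (-(trIP (u + h) ξ)) - 1) -
        (Real.exp (-(trIP u ξ)) - 1)) (fun ξ => -(trIP h ξ * Real.exp (-(trIP u ξ))))
        (((aux_meas_exp _).sub_const _).sub ((aux_meas_exp _).sub_const _))
        ((aux_meas_trIP h).mul (aux_meas_exp u)).neg
        (d * ‖u + h‖ + d * ‖u‖) _ (by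
          intro ξ hξ
          rw [add_mul]
          exact (abs_sub _ _).trans (add_le_add (aux_bd_exp hv ξ hξ) (aux_bd_exp hu ξ hξ)))
        (by intro ξ hξ; rw [abs_neg]; exact aux_bd_lin hu h ξ hξ),
      ← aux_muInt_sub P _ _ ((aux_meas_exp _).sub_const _) ((aux_meas_exp _).sub_const _) _ _
        (aux_bd_exp hv) (aux_bd_exp hu), hn]
    unfold Rfun DRf
    simp only [add_mul, mul_add, smul_add, map_add]
    abel
  have b1 : ‖h * P.α * h‖ ≤ ‖h‖ * ‖P.α‖ * ‖h‖ :=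
    (Matrix.frobenius_norm_mul _ _).trans
      (mul_le_mul_of_nonneg_right (Matrix.frobenius_norm_mul _ _) (norm_nonneg _))
  have b3 := aux_muInt_le_G P hu hv (fun ξ => ((Real.exp (-(trIP (u + h) ξ)) - 1) -
        (Real.exp (-(trIP u ξ)) - 1)) - (-(trIP h ξ * Real.exp (-(trIP u ξ)))))
        (d * ‖h‖) (by
    intro ξ _
    have h1 := aux_exp (trIP u ξ) (trIP h ξ)
    rw [← aux_trIP_add] at h1
    have h2 : ((Real.exp (-(trIP (u + h) ξ)) - 1) -
        (Real.exp (-(trIP u ξ)) - 1)) - (-(trIP h ξ * Real.exp (-(trIP u ξ)))) =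
        Real.exp (-(trIP (u + h) ξ)) - Real.exp (-(trIP u ξ)) +
          trIP h ξ * Real.exp (-(trIP u ξ)) := by ring
    rw [h2]
    refine h1.trans (mul_le_mul_of_nonneg_right ?_ (abs_nonneg _))
    rw [mul_assoc]
    exact aux_trIP_le h ξ)
  rw [e]
  refine (norm_sub_le _ _).trans ?_
  rw [norm_smul]
  have : ‖(-2 : ℝ)‖ = 2 := by norm_num
  rw [this]
  nlinarith

lemma aux_part2 (P : Admissible d) {u : Mat d} (hu : u.PosSemidef) :
    Tendsto (fun h : Mat d =>
          ‖Rfun P.α P.Bt P.ν P.ρ (u + h) - Rfun P.α P.Bt P.ν P.ρ u -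
            DRf P.α P.Bt P.ν P.ρ u h‖ / ‖h‖)
        (𝓝[{h : Mat d | h.IsSymm ∧ (u + h).PosSemidef ∧ h ≠ 0}] 0) (𝓝 0) := by
  have hG : Tendsto (fun h : Mat d => auxG P u (u + h))
      (𝓝[{h : Mat d | h.IsSymm ∧ (u + h).PosSemidef ∧ h ≠ 0}] 0) (𝓝 0) := by
    refine (aux_G_tendsto P hu).comp (tendsto_nhdsWithin_iff.2 ⟨?_, ?_⟩)
    · have hc : Continuous fun h : Mat d => u + h := by fun_prop
      simpa using (hc.tendsto 0).mono_left nhdsWithin_le_nhds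
    · filter_upwards [self_mem_nhdsWithin] with h hh
      exact hh.2.1
  have hN : Tendsto (fun h : Mat d => ‖h‖)
      (𝓝[{h : Mat d | h.IsSymm ∧ (u + h).PosSemidef ∧ h ≠ 0}] 0) (𝓝 0) := by
    simpa using ((aux_norm_cont (d := d)).tendsto 0).mono_left nhdsWithin_le_nhds
  have hT := (hN.const_mul (2 * ‖P.α‖)).add (hG.const_mul ((d * d : ℝ) * d))
  simp only [mul_zero, add_zero] at hT
  refine squeeze_zero' (Eventually.of_forall fun h => by positivity) ?_ hT
  filter_upwards [self_mem_nhdsWithin] with h hh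
  exact div_le_of_le_mul₀ (norm_nonneg _) (by
    have : 0 ≤ auxG P u (u + h) := by
      refine integral_nonneg_of_ae ?_
      filter_upwards [P.hρpsd] with ξ h1
      exact mul_nonneg (abs_nonneg _) (mul_nonneg (norm_nonneg _) h1.trace_nonneg)
    positivity) (aux_R P hu hh.2.1)

/-- Lemma 3.2 (a): `R` is Fréchet differentiable at every `u ∈ S_d^{++}` (along symmetric
directions) with derivative `DR(u)`, the map `u ↦ DR(u)` is continuous on `S_d^+` in the
operator norm, and `R` is (continuously) differentiable on all of `S_d^+` with the same
formula for the derivative (differentiability within `S_d^+` at boundary points). -/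
theorem R_continuously_differentiable
    (d : ℕ) (hd : 2 ≤ d) (P : Admissible d) :
    (∀ u : Mat d, u.PosDef →
      Tendsto (fun h : Mat d =>
          ‖Rfun P.α P.Bt P.ν P.ρ (u + h) - Rfun P.α P.Bt P.ν P.ρ u -
            DRf P.α P.Bt P.ν P.ρ u h‖ / ‖h‖)
        (𝓝[{h : Mat d | h.IsSymm ∧ h ≠ 0}] 0) (𝓝 0)) ∧
    (∀ u : Mat d, u.PosSemidef →
      Tendsto (fun h : Mat d =>
          ‖Rfun P.α P.Bt P.ν P.ρ (u + h) - Rfun P.α P.Bt P.ν P.ρ u -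
            DRf P.α P.Bt P.ν P.ρ u h‖ / ‖h‖)
        (𝓝[{h : Mat d | h.IsSymm ∧ (u + h).PosSemidef ∧ h ≠ 0}] 0) (𝓝 0)) ∧
    (∀ u : Mat d, u.PosSemidef → ∀ ε : ℝ, 0 < ε → ∃ η : ℝ, 0 < η ∧
      ∀ v : Mat d, v.PosSemidef → ‖v - u‖ < η → ∀ h : Mat d, h.IsSymm →
        ‖DRf P.α P.Bt P.ν P.ρ v h - DRf P.α P.Bt P.ν P.ρ u h‖ ≤ ε * ‖h‖) := by
  refine ⟨fun u hu => ?_, fun u hu => aux_part2 P hu, fun u hu ε hε => ?_⟩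
  · refine (aux_part2 P hu.posSemidef).mono_left ?_
    rw [nhdsWithin, nhdsWithin]
    refine le_inf inf_le_left ?_
    rw [le_principal_iff]
    filter_upwards [mem_inf_of_left (aux_open hu), mem_inf_of_right (mem_principal_self _)]
      with h h1 h2
    exact ⟨h2.1, h1 h2.1, h2.2⟩
  · have hN : Tendsto (fun v : Mat d => ‖v - u‖) (𝓝[{v : Mat d | v.PosSemidef}] u) (𝓝 0) := by
      have hc : Continuous fun v : Mat d => ‖v - u‖ := by fun_prop
      simpa using (hc.tendsto u).mono_left nhdsWithin_le_nhds
    have hT := (hN.const_mul (4 * ‖P.α‖)).add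
      ((aux_G_tendsto P hu).const_mul ((d * d : ℝ) * d))
    simp only [mul_zero, add_zero] at hT
    have hev := hT.eventually (gt_mem_nhds hε)
    obtain ⟨η, hη, hb⟩ := Metric.mem_nhdsWithin_iff.1 hev
    refine ⟨η, hη, fun v hv hvu h _ => (aux_DR P hu hv h).trans ?_⟩
    refine mul_le_mul_of_nonneg_right (le_of_lt ?_) (norm_nonneg _)
    exact hb ⟨by rw [Metric.mem_ball, dist_eq_norm]; exact hvu, hv⟩
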